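/- Let k be a field, R an associative unital k-algebra, and L, M, N finitely generated left R-modules. If L ⇒_deg M and M ⇒_deg N, then there exists an integer n > 0 such that L^{⊕n} ⇒_deg N^{⊕n}. -/

import Mathlib

open Polynomial TensorProduct

noncomputable section

/-- The prime ideal `(t)` of the polynomial ring `k[t]`. -/
def tIdeal (k : Type) [Field k] : Ideal (Polynomial k) := Ideal.span {Polynomial.X}

instance tIdeal_isPrime (k : Type) [Field k] : (tIdeal k).IsPrime := by
  have h : tIdeal k = RingHom.ker (Polynomial.evalRingHom (0 : k)) := by
    rw [Polynomial.ker_evalRingHom]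
    simp [tIdeal]
  rw [h]
  exact RingHom.ker_isPrime _

/-- `V = k[t]_{(t)}`, the localization of the polynomial ring `k[t]` at the prime ideal `(t)`. -/
def DegV (k : Type) [Field k] : Type := Localization.AtPrime (tIdeal k)

instance (k : Type) [Field k] : CommRing (DegV k) :=
  inferInstanceAs (CommRing (Localization.AtPrime (tIdeal k)))

instance (k : Type) [Field k] : Algebra (Polynomial k) (DegV k) :=
  inferInstanceAs (Algebra (Polynomial k) (Localization.AtPrime (tIdeal k)))

instance (k : Type) [Field k] : Algebra k (DegV k) :=
  inferInstanceAs (Algebra k (Localization.AtPrime (tIdeal k)))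

instance (k : Type) [Field k] : IsScalarTower k (Polynomial k) (DegV k) :=
  inferInstanceAs (IsScalarTower k (Polynomial k) (Localization.AtPrime (tIdeal k)))

/-- The element `t` of `V = k[t]_{(t)}`. -/
def degT (k : Type) [Field k] : DegV k := algebraMap (Polynomial k) (DegV k) Polynomial.X

/-- `K = V[t⁻¹]`, which is the fraction field `k(t)` of `V = k[t]_{(t)}`. -/
def DegK (k : Type) [Field k] : Type := Localization (Submonoid.powers (degT k))

instance (k : Type) [Field k] : CommRing (DegK k) :=
  inferInstanceAs (CommRing (Localization (Submonoid.powers (degT k))))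

instance (k : Type) [Field k] : Algebra (DegV k) (DegK k) :=
  inferInstanceAs (Algebra (DegV k) (Localization (Submonoid.powers (degT k))))

instance (k : Type) [Field k] : Algebra k (DegK k) :=
  inferInstanceAs (Algebra k (Localization (Submonoid.powers (degT k))))

/-- The localized module `Q[t⁻¹]` is a module over `K = V[t⁻¹]`. -/
instance (k : Type) [Field k] (Q : Type) [AddCommGroup Q] [Module (DegV k) Q] :
    Module (DegK k) (LocalizedModule (Submonoid.powers (degT k)) Q) :=
  inferInstanceAs (Module (Localization (Submonoid.powers (degT k)))
    (LocalizedModule (Submonoid.powers (degT k)) Q))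

section

variable (k : Type) [Field k] (R : Type) [Ring R] [Algebra k R]

/-- `1 ⊗ t` is central in `R ⊗[k] V`. -/
theorem degT_central (x : R ⊗[k] DegV k) :
    x * ((1 : R) ⊗ₜ[k] degT k) = ((1 : R) ⊗ₜ[k] degT k) * x := by
  induction x with
  | zero => simp
  | tmul a v => simp [Algebra.TensorProduct.tmul_mul_tmul, mul_comm]
  | add x y hx hy => simp [add_mul, mul_add, hx, hy]

/-- Multiplication by `1 ⊗ t` on an `R ⊗[k] V`-module, as an `R ⊗[k] V`-linear map. -/
def tSmul (Q : Type) [AddCommGroup Q] [Module (R ⊗[k] DegV k) Q] :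
    Q →ₗ[R ⊗[k] DegV k] Q where
  toFun q := ((1 : R) ⊗ₜ[k] degT k) • q
  map_add' := smul_add _
  map_smul' x q := by
    simp only [RingHom.id_apply, ← mul_smul, degT_central]

/-- The `R`-module structure on an `R ⊗[k] V`-module obtained by restriction of scalars
along `R → R ⊗[k] V`. -/
def rRestrict (Q : Type) [AddCommGroup Q] [Module (R ⊗[k] DegV k) Q] : Module R Q :=
  Module.compHom Q (Algebra.TensorProduct.includeLeftRingHom : R →+* R ⊗[k] DegV k)

/-- The `V`-module structure on an `R ⊗[k] V`-module obtained by restriction of scalars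
along `V → R ⊗[k] V`. -/
def vRestrict (Q : Type) [AddCommGroup Q] [Module (R ⊗[k] DegV k) Q] : Module (DegV k) Q :=
  Module.compHom Q
    ((Algebra.TensorProduct.includeRight : DegV k →ₐ[k] R ⊗[k] DegV k) : DegV k →+* R ⊗[k] DegV k)

/-- The action of `r : R` on an `R ⊗[k] V`-module `Q`, as a `V`-linear endomorphism of `Q`. -/
def rAct (Q : Type) [AddCommGroup Q] [Module (R ⊗[k] DegV k) Q] (r : R) :
    letI := vRestrict k R Q
    Q →ₗ[DegV k] Q :=
  letI := vRestrict k R Q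
  { toFun := fun q => (r ⊗ₜ[k] (1 : DegV k)) • q
    map_add' := smul_add _
    map_smul' := fun v q => by
      show (r ⊗ₜ[k] (1 : DegV k)) • (((1 : R) ⊗ₜ[k] v) • q)
        = ((1 : R) ⊗ₜ[k] v) • ((r ⊗ₜ[k] (1 : DegV k)) • q)
      rw [← mul_smul, ← mul_smul, Algebra.TensorProduct.tmul_mul_tmul,
        Algebra.TensorProduct.tmul_mul_tmul, one_mul, mul_one, one_mul, mul_one] }

/-- The action of `r : R` on a module `M`, as a `k`-linear endomorphism of `M`
(where `M` is viewed as a `k`-module by restriction of scalars along `k → R`). -/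
def rActK (M : Type) [AddCommGroup M] [Module R M] (r : R) :
    letI := Module.compHom M (algebraMap k R)
    M →ₗ[k] M :=
  letI := Module.compHom M (algebraMap k R)
  { toFun := fun m => r • m
    map_add' := smul_add r
    map_smul' := fun c m => by
      show r • ((algebraMap k R c) • m) = (algebraMap k R c) • (r • m)
      rw [← mul_smul, ← mul_smul, Algebra.commutes] }

/-- Degeneration of modules (Yoshino): `M ⇒_deg N` iff there is a finitely generated
`R ⊗[k] V`-module `Q`, flat over `V`, with `Q/tQ ≅ N` as `R`-modules and
`Q_t = Q[t⁻¹] ≅ M ⊗[k] K` compatibly with the `R`- and `K`-actions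
(i.e. as `R ⊗[k] K`-modules). -/
def Degenerates (M N : Type) [AddCommGroup M] [Module R M] [AddCommGroup N] [Module R N] :
    Prop :=
  ∃ (Q : Type) (_ : AddCommGroup Q) (_ : Module (R ⊗[k] DegV k) Q),
    Module.Finite (R ⊗[k] DegV k) Q ∧
    (letI := vRestrict k R Q; Module.Flat (DegV k) Q) ∧
    -- `Q/tQ ≅ N` as `R`-modules
    (letI := rRestrict k R (Q ⧸ LinearMap.range (tSmul k R Q))
     Nonempty ((Q ⧸ LinearMap.range (tSmul k R Q)) ≃ₗ[R] N)) ∧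
    -- `Q_t ≅ M ⊗_k K` as `R ⊗_k K`-modules, i.e. compatibly with both actions
    (letI := vRestrict k R Q
     letI : Module k M := Module.compHom M (algebraMap k R)
     ∃ f : LocalizedModule (Submonoid.powers (degT k)) Q ≃+ (M ⊗[k] DegK k),
       (∀ (c : DegK k) (x : LocalizedModule (Submonoid.powers (degT k)) Q),
          f (c • x) = LinearMap.lTensor M (LinearMap.mulLeft k c) (f x)) ∧
       (∀ (r : R) (x : LocalizedModule (Submonoid.powers (degT k)) Q),
          f (LocalizedModule.map (Submonoid.powers (degT k)) (rAct k R Q r) x)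
            = LinearMap.rTensor (DegK k) (rActK k R M r) (f x)))

end

section VFacts
variable (k : Type) [Field k]

instance : IsDomain (DegV k) := inferInstanceAs (IsDomain (Localization.AtPrime (tIdeal k)))
instance : IsLocalization.AtPrime (DegV k) (tIdeal k) :=
  inferInstanceAs (IsLocalization.AtPrime (Localization.AtPrime (tIdeal k)) (tIdeal k))
instance : IsDedekindDomain (DegV k) :=
  IsLocalization.isDedekindDomain k[X] (Ideal.primeCompl_le_nonZeroDivisors (tIdeal k)) (DegV k)
instance : IsLocalization (Submonoid.powers (degT k)) (DegK k) :=
  inferInstanceAs (IsLocalization (Submonoid.powers (degT k))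
    (Localization (Submonoid.powers (degT k))))
instance : IsScalarTower k (DegV k) (DegK k) :=
  inferInstanceAs (IsScalarTower k (DegV k) (Localization (Submonoid.powers (degT k))))

theorem mem_tIdeal (p : k[X]) : p ∈ tIdeal k ↔ p.coeff 0 = 0 := by
  rw [tIdeal, Ideal.mem_span_singleton, Polynomial.X_dvd_iff]

theorem algV_injective : Function.Injective (algebraMap k[X] (DegV k)) :=
  IsLocalization.injective (DegV k) (Ideal.primeCompl_le_nonZeroDivisors (tIdeal k))

theorem degT_ne_zero : degT k ≠ 0 := by
  intro h
  have := algV_injective k (a₁ := X) (a₂ := 0) (by rw [map_zero]; exact h)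
  exact Polynomial.X_ne_zero this

def degEps : DegV k →ₐ[k] k :=
  IsLocalization.liftAlgHom (M := (tIdeal k).primeCompl) (f := Polynomial.aeval (0 : k)) (by
    rintro ⟨y, hy⟩
    have : y.coeff 0 ≠ 0 := fun h => hy ((mem_tIdeal k y).2 h)
    simpa [Polynomial.aeval_def, Polynomial.coeff_zero_eq_eval_zero] using this)

theorem degEps_alg (p : k[X]) : degEps k (algebraMap _ _ p) = p.coeff 0 := by
  simp [degEps, Polynomial.aeval_def, Polynomial.coeff_zero_eq_eval_zero]

theorem degEps_eq_zero (v : DegV k) : degEps k v = 0 ↔ ∃ v', v = degT k * v' := by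
  constructor
  · intro h
    obtain ⟨⟨p, q⟩, hpq⟩ := IsLocalization.surj (tIdeal k).primeCompl v
    have hp : p.coeff 0 = 0 := by
      rw [← degEps_alg, ← hpq, map_mul, h, zero_mul]
    obtain ⟨p', rfl⟩ := Polynomial.X_dvd_iff.2 hp
    obtain ⟨u, hu⟩ := IsLocalization.map_units (DegV k) q
    refine ⟨algebraMap _ _ p' * ((u⁻¹ : (DegV k)ˣ) : DegV k), ?_⟩
    simp only [map_mul, ← hu] at hpq
    rw [← mul_assoc, Units.eq_mul_inv_iff_mul_eq]
    exact hpq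
  · rintro ⟨v', rfl⟩
    rw [map_mul, degT, degEps_alg]
    simp

def degPhi (m : ℕ) (hm : 0 < m) : DegV k →ₐ[k] DegV k :=
  IsLocalization.liftAlgHom (M := (tIdeal k).primeCompl)
    (f := (Algebra.ofId k[X] (DegV k)).restrictScalars k |>.comp (Polynomial.expand k m |>.restrictScalars k)) (by
    rintro ⟨y, hy⟩
    have : y.coeff 0 ≠ 0 := fun h => hy ((mem_tIdeal k y).2 h)
    refine IsLocalization.map_units (DegV k) (⟨Polynomial.expand k m y, ?_⟩ : (tIdeal k).primeCompl)
    intro h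
    rw [SetLike.mem_coe, mem_tIdeal, Polynomial.coeff_expand hm] at h
    simp at h
    exact this h)

theorem degPhi_alg (m : ℕ) (hm : 0 < m) (p : k[X]) :
    degPhi k m hm (algebraMap _ _ p) = algebraMap _ _ (Polynomial.expand k m p) := by
  simp [degPhi, Algebra.ofId_apply]

theorem degPhi_t (m : ℕ) (hm : 0 < m) : degPhi k m hm (degT k) = degT k ^ m := by
  rw [degT, degPhi_alg, Polynomial.expand_X, map_pow]

theorem degPhi_injective (m : ℕ) (hm : 0 < m) : Function.Injective (degPhi k m hm) := by
  rw [injective_iff_map_eq_zero]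
  intro v h
  obtain ⟨⟨p, q⟩, hpq⟩ := IsLocalization.surj (tIdeal k).primeCompl v
  have h1 := congrArg (degPhi k m hm) hpq
  simp only at h1
  rw [map_mul, h, zero_mul, degPhi_alg] at h1
  have h2 := algV_injective k (h1.symm.trans (map_zero _).symm)
  rw [Polynomial.expand_eq_zero hm] at h2
  rw [h2, map_zero] at hpq
  exact (IsUnit.mul_left_eq_zero (IsLocalization.map_units (DegV k) q)).1 hpq

theorem flat_of_injective {V W : Type} [CommRing V] [IsDedekindDomain V] [CommRing W] [IsDomain W]
    (φ : V →+* W) (h : Function.Injective φ) : letI := φ.toAlgebra; Module.Flat V W := by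
  let : Algebra V W := φ.toAlgebra
  have : FaithfulSMul V W := (faithfulSMul_iff_algebraMap_injective V W).2 h
  have : Module.IsTorsionFree V W := inferInstance
  infer_instance

end VFacts
section Core

/-- A convenient lattice form of degeneration over a base `V` with parameter `t`. -/
def PreDeg (k : Type) [Field k] (R : Type) [Ring R] [Algebra k R] (V : Type) [CommRing V]
    [Algebra k V] (t : V) (a : ℕ) (M N : Type) [AddCommGroup M] [Module k M] [Module R M]
    [IsScalarTower k R M] [AddCommGroup N] [Module R N] : Prop :=
  ∃ (Q : Type) (_ : AddCommGroup Q) (_ : Module V Q) (ρ : R → Q →ₗ[V] Q)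
    (j : Q →ₗ[V] V ⊗[k] M) (π : Q →+ N),
    Function.Injective j ∧
    (∀ r q, j (ρ r q) = (Algebra.lsmul k k M r).baseChange V (j q)) ∧
    (∀ y, ∃ q, j q = t ^ a • y) ∧
    Function.Surjective π ∧
    (∀ r q, π (ρ r q) = r • π q) ∧
    (∀ q, π q = 0 ↔ ∃ q', q = t • q') ∧
    ∃ F : Set Q, F.Finite ∧ ∀ S : Submodule V Q, (∀ r, ∀ x ∈ S, ρ r x ∈ S) → F ⊆ S → S = ⊤

/-- Gluing: `X`, `Y` agree modulo `s ^ m`, and `Q2 ⊆ Y` contains `s ^ a Y` with `a < m`. -/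
theorem glue_exists {W R X Y Z Q2 N : Type} [CommRing W] [Ring R]
    [AddCommGroup X] [Module W X] [AddCommGroup Y] [Module W Y] [AddCommGroup Z] [Module W Z]
    [AddCommGroup Q2] [Module W Q2] [AddCommGroup N] [Module R N]
    (s : W) (a m : ℕ) (ham : a < m)
    (ρX : R → X →ₗ[W] X) (ρY : R → Y →ₗ[W] Y) (ρZ : R → Z →ₗ[W] Z) (ρ2 : R → Q2 →ₗ[W] Q2)
    (α : X →ₗ[W] Z) (β : Y →ₗ[W] Z) (hα : Function.Surjective α) (hβ : Function.Surjective β)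
    (hαρ : ∀ r x, α (ρX r x) = ρZ r (α x)) (hβρ : ∀ r y, β (ρY r y) = ρZ r (β y))
    (kα : ∀ x, α x = 0 → ∃ x', x = s ^ m • x') (kβ : ∀ y, β y = 0 → ∃ y', y = s ^ m • y')
    (j2 : Q2 →ₗ[W] Y) (hj2 : Function.Injective j2) (hj2ρ : ∀ r q, j2 (ρ2 r q) = ρY r (j2 q))
    (hc : ∀ y, ∃ q, j2 q = s ^ a • y)
    (π2 : Q2 →+ N) (hπ2 : Function.Surjective π2) (hπ2ρ : ∀ r q, π2 (ρ2 r q) = r • π2 q)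
    (kπ2 : ∀ q, π2 q = 0 ↔ ∃ q', q = s • q')
    (FX : Set X) (hFX : FX.Finite)
    (hFX' : ∀ S : Submodule W X, (∀ r, ∀ x ∈ S, ρX r x ∈ S) → FX ⊆ S → S = ⊤)
    (F2 : Set Q2) (hF2 : F2.Finite)
    (hF2' : ∀ S : Submodule W Q2, (∀ r, ∀ x ∈ S, ρ2 r x ∈ S) → F2 ⊆ S → S = ⊤) :
    ∃ (P : Submodule W X) (ρ : R → P →ₗ[W] P) (π : P →+ N),
      (∀ r (p : P), (ρ r p : X) = ρX r p) ∧ (∀ x, s ^ m • x ∈ P) ∧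
      Function.Surjective π ∧ (∀ r p, π (ρ r p) = r • π p) ∧
      (∀ p, π p = 0 ↔ ∃ p', p = s • p') ∧
      ∃ F : Set P, F.Finite ∧
        ∀ S : Submodule W P, (∀ r, ∀ x ∈ S, ρ r x ∈ S) → F ⊆ S → S = ⊤ := by
  classical
  let P : Submodule W X := (LinearMap.range (β ∘ₗ j2)).comap α
  have memP : ∀ x, x ∈ P ↔ ∃ q, β (j2 q) = α x := fun x => Iff.rfl
  have hρP : ∀ r, ∀ x ∈ P, ρX r x ∈ P := by
    intro r x hx
    obtain ⟨q, hq⟩ := (memP x).1 hx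
    exact (memP _).2 ⟨ρ2 r q, by rw [hj2ρ, hβρ, hq, hαρ]⟩
  have hc' : ∀ n, a ≤ n → ∀ y, ∃ q, j2 q = s ^ n • y := by
    intro n hn y
    obtain ⟨q, hq⟩ := hc y
    refine ⟨s ^ (n - a) • q, ?_⟩
    rw [map_smul, hq, smul_smul, ← pow_add, Nat.sub_add_cancel hn]
  have hsP : ∀ n, a ≤ n → ∀ x, s ^ n • x ∈ P := by
    intro n hn x
    obtain ⟨y, hy⟩ := hβ (α x)
    obtain ⟨q, hq⟩ := hc' n hn y
    exact (memP _).2 ⟨q, by rw [hq, map_smul, hy, map_smul]⟩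
  -- well-definedness
  have wd0 : ∀ q, β (j2 q) = 0 → π2 q = 0 := by
    intro q hq
    obtain ⟨y, hy⟩ := kβ _ hq
    obtain ⟨q', hq'⟩ := hc' (m - 1) (by omega) y
    refine (kπ2 q).2 ⟨q', hj2 ?_⟩
    rw [map_smul, hq', smul_smul, ← pow_succ', Nat.sub_add_cancel (by omega), hy]
  have wd : ∀ q q', β (j2 q) = β (j2 q') → π2 q = π2 q' := by
    intro q q' h
    have := wd0 (q - q') (by rw [map_sub, map_sub, h, sub_self])
    rwa [map_sub, sub_eq_zero] at this
  choose c hcc using fun p : P => (memP p).1 p.2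
  let π : P →+ N :=
    { toFun := fun p => π2 (c p)
      map_zero' := wd0 _ (by rw [hcc]; simp)
      map_add' := fun p p' => by
        rw [← map_add]
        apply wd
        rw [hcc, map_add, map_add, hcc, hcc, Submodule.coe_add, map_add] }
  have hπ : ∀ (p : P) q, β (j2 q) = α p → π p = π2 q := fun p q h =>
    wd _ _ (by rw [hcc, h])
  let ρ : R → P →ₗ[W] P := fun r => (ρX r).restrict (hρP r)
  have lift2 : ∀ q, ∃ p : P, β (j2 q) = α p := by
    intro q
    obtain ⟨x, hx⟩ := hα (β (j2 q))
    exact ⟨⟨x, (memP _).2 ⟨q, hx.symm⟩⟩, hx.symm⟩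
  choose l hl using lift2
  refine ⟨P, ρ, π, fun r p => rfl, hsP m ham.le, ?_, ?_, ?_, ?_⟩
  · intro n
    obtain ⟨q, rfl⟩ := hπ2 n
    exact ⟨l q, hπ _ _ (hl q)⟩
  · intro r p
    rw [hπ (ρ r p) (ρ2 r (c p)), hπ2ρ]
    · rfl
    · rw [hj2ρ, hβρ, hcc]
      exact (hαρ r p).symm
  · intro p
    constructor
    · intro h
      obtain ⟨q', hq'⟩ := (kπ2 (c p)).1 h
      have h1 : α ((p : X) - s • (l q' : X)) = 0 := by
        rw [map_sub, ← hcc, hq', map_smul, map_smul, map_smul, hl, sub_self]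
      obtain ⟨x, hx⟩ := kα _ h1
      refine ⟨l q' + ⟨s ^ (m - 1) • x, hsP _ (by omega) x⟩, ?_⟩
      apply Subtype.ext
      simp only [Submodule.coe_smul, Submodule.coe_add, smul_add, smul_smul, ← pow_succ']
      rw [Nat.sub_add_cancel (by omega), ← hx]
      abel
    · rintro ⟨p', rfl⟩
      rw [hπ (s • p') (s • c p') (by rw [map_smul, map_smul, hcc, Submodule.coe_smul, map_smul])]
      exact (kπ2 _).2 ⟨_, rfl⟩
  · refine ⟨(fun x => (⟨s ^ m • x, hsP m ham.le x⟩ : P)) '' FX ∪ l '' F2,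
      (hFX.image _).union (hF2.image _), ?_⟩
    intro S hS hF
    have h1 : ∀ x, (⟨s ^ m • x, hsP m ham.le x⟩ : P) ∈ S := by
      let g : X →ₗ[W] P := ((s ^ m) • (LinearMap.id : X →ₗ[W] X)).codRestrict P
        (fun x => hsP m ham.le x)
      have := hFX' (S.comap g) (by
        intro r x hx
        have h := hS r _ hx
        have e : ρ r (g x) = g (ρX r x) := by
          apply Subtype.ext
          change ρX r (s ^ m • x) = s ^ m • ρX r x
          rw [map_smul]
        rw [e] at h
        exact h) (by
        intro x hx
        exact hF (Or.inl ⟨x, hx, rfl⟩))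
      intro x
      have hx : x ∈ S.comap g := by rw [this]; trivial
      exact hx
    let S2 : Submodule W Q2 := (S.map (α ∘ₗ P.subtype)).comap (β ∘ₗ j2)
    have h2 : S2 = ⊤ := by
      apply hF2'
      · rintro r q ⟨p, hp, hpq⟩
        refine ⟨ρ r p, hS r p hp, ?_⟩
        change α (ρX r p) = β (j2 (ρ2 r q))
        rw [hαρ, hj2ρ, hβρ]
        exact congrArg _ hpq
      · intro q hq
        exact ⟨l q, hF (Or.inr ⟨q, hq, rfl⟩), (hl q).symm⟩
    rw [eq_top_iff]
    intro p _
    have hq : c p ∈ S2 := by rw [h2]; trivial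
    obtain ⟨p', hp', hpp⟩ := hq
    have h3 : α ((p : X) - p') = 0 := by
      rw [map_sub, ← hcc, sub_eq_zero]
      exact hpp.symm
    obtain ⟨x, hx⟩ := kα _ h3
    have : p = p' + ⟨s ^ m • x, hsP m ham.le x⟩ := by
      apply Subtype.ext
      simp only [Submodule.coe_add]
      rw [← hx]; abel
    rw [this]
    exact S.add_mem hp' (h1 x)

theorem PreDeg.trans {k : Type} [Field k] {R : Type} [Ring R] [Algebra k R]
    {V W : Type} [CommRing V] [IsDedekindDomain V] [Algebra k V]
    [CommRing W] [IsDomain W] [Algebra k W]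
    {t : V} {s : W} {a b m : ℕ} (hbm : b < m) (φ : V →ₐ[k] W) (hφ : φ t = s ^ m)
    (hφi : Function.Injective φ)
    (ε : V →ₐ[k] k) (hε : ∀ v, ε v = 0 ↔ ∃ v', v = t * v')
    {L M N : Type} [AddCommGroup L] [Module k L] [Module R L] [IsScalarTower k R L]
    [AddCommGroup M] [Module k M] [Module R M] [IsScalarTower k R M] [AddCommGroup N] [Module R N]
    (h1 : PreDeg k R V t a L M) (h2 : PreDeg k R W s b M N) :
    PreDeg k R W s (m * a + m) L N := by
  classical
  obtain ⟨Q1, _, _, ρ1, j1, π1, j1i, j1ρ, c1, π1s, π1ρ, k1, F1, hF1, gen1⟩ := h1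
  obtain ⟨Q2, _, _, ρ2, j2, π2, j2i, j2ρ, c2, π2s, π2ρ, k2, F2, hF2, gen2⟩ := h2
  let : Algebra V W := φ.toAlgebra
  have hflat : Module.Flat V W := flat_of_injective (φ : V →+* W) hφi
  have : IsScalarTower k V W := IsScalarTower.of_algebraMap_eq' φ.comp_algebraMap.symm
  have hts : algebraMap V W t = s ^ m := hφ
  let : Module V M := Module.compHom M (ε : V →+* k)
  have vsm : ∀ (v : V) (x : M), v • x = ε v • x := fun _ _ => rfl
  have : IsScalarTower k V M := ⟨fun c v x => by
    rw [vsm, vsm, map_smul, smul_assoc]⟩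
  -- `π1` is `V`-linear
  have π1k : ∀ (c : k) q, π1 (algebraMap k V c • q) = c • π1 q := by
    intro c q
    have : algebraMap k V c • q = ρ1 (algebraMap k R c) q := by
      apply j1i
      rw [j1ρ, map_smul]
      generalize j1 q = z
      induction z with
      | zero => simp
      | add x y hx hy => rw [smul_add, hx, hy, map_add]
      | tmul v x =>
        simp only [LinearMap.baseChange_tmul, Algebra.lsmul_coe, algebraMap_smul]
        simp
    rw [this, π1ρ, algebraMap_smul]
  let p1 : Q1 →ₗ[V] M :=
    { toFun := π1
      map_add' := map_add π1
      map_smul' := fun v q => by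
        obtain ⟨v', hv'⟩ := (hε (v - algebraMap k V (ε v))).1 (by simp)
        have : v • q = algebraMap k V (ε v) • q + t • (v' • q) := by
          rw [smul_smul, ← hv', ← add_smul]; congr 1; ring
        rw [this, map_add, π1k, (k1 _).2 ⟨_, rfl⟩, add_zero]
        rfl }
  let rM : R → M →ₗ[V] M := fun r =>
    { toFun := fun x => r • x
      map_add' := smul_add r
      map_smul' := fun v x => by
        rw [vsm]; exact smul_comm _ _ _ }
  let α : W ⊗[V] Q1 →ₗ[W] W ⊗[V] M := p1.baseChange W
  let β : W ⊗[k] M →ₗ[W] W ⊗[V] M :=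
    LinearMap.liftBaseChange W (((TensorProduct.mk V W M 1).restrictScalars k))
  have βt : ∀ w x, β (w ⊗ₜ x) = w ⊗ₜ x := by
    intro w x
    simp [β, TensorProduct.smul_tmul']
  have hsX : ∀ x : W ⊗[V] Q1, s ^ m • x = t • x := by
    intro x; rw [← hts, algebraMap_smul]
  have hα : Function.Surjective α := LinearMap.lTensor_surjective W π1s
  have hβ : Function.Surjective β := by
    intro z
    induction z with
    | zero => exact ⟨0, map_zero _⟩
    | add x y hx hy =>
      obtain ⟨x, rfl⟩ := hx
      obtain ⟨y, rfl⟩ := hy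
      exact ⟨x + y, map_add _ _ _⟩
    | tmul w x => exact ⟨w ⊗ₜ x, βt w x⟩
  have kα : ∀ x, α x = 0 → ∃ x', x = s ^ m • x' := by
    have ex : Function.Exact (LinearMap.lsmul V Q1 t) p1 := by
      intro q
      constructor
      · intro h
        obtain ⟨q', rfl⟩ := (k1 q).1 h
        exact ⟨q', rfl⟩
      · rintro ⟨q', rfl⟩
        exact (k1 _).2 ⟨q', rfl⟩
    have ex2 := lTensor_exact W ex π1s
    intro x hx
    obtain ⟨x', hx'⟩ := (ex2 x).1 hx
    refine ⟨x', ?_⟩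
    rw [← hx', hsX]
    clear hx'
    induction x' with
    | zero => simp
    | add x y hx hy => rw [map_add, hx, hy, smul_add]
    | tmul w q => simp
  have kβ : ∀ y, β y = 0 → ∃ y', y = s ^ m • y' := by
    let I : Submodule W (W ⊗[k] M) := LinearMap.range (LinearMap.lsmul W (W ⊗[k] M) (s ^ m))
    let g : M →ₗ[V] (W ⊗[k] M) ⧸ I :=
      { toFun := fun x => I.mkQ (1 ⊗ₜ x)
        map_add' := fun x y => by rw [TensorProduct.tmul_add, map_add]
        map_smul' := fun v x => by
          obtain ⟨v', hv'⟩ := (hε (v - algebraMap k V (ε v))).1 (by simp)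
          rw [RingHom.id_apply, vsm, ← algebraMap_smul W v (I.mkQ _), ← map_smul, ← sub_eq_zero,
            ← map_sub,
            Submodule.mkQ_apply, Submodule.Quotient.mk_eq_zero]
          refine ⟨- (algebraMap V W v' • (1 ⊗ₜ x)), ?_⟩
          have hv : algebraMap V W v = algebraMap k W (ε v) + s ^ m * algebraMap V W v' := by
            rw [← hts, ← map_mul, ← hv', map_sub, ← IsScalarTower.algebraMap_apply]; ring
          rw [hv, LinearMap.lsmul_apply, smul_neg, add_smul, smul_smul, TensorProduct.tmul_smul,
            algebraMap_smul]
          abel }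
    let γ : W ⊗[V] M →ₗ[W] (W ⊗[k] M) ⧸ I := LinearMap.liftBaseChange W g
    have hγ : ∀ y, γ (β y) = I.mkQ y := by
      intro y
      induction y with
      | zero => simp
      | add x y hx hy => rw [map_add, map_add, hx, hy, map_add]
      | tmul w x =>
        rw [βt]
        simp only [γ, LinearMap.liftBaseChange_tmul]
        change w • I.mkQ (1 ⊗ₜ x) = _
        rw [← map_smul, TensorProduct.smul_tmul', smul_eq_mul, mul_one]
    intro y hy
    have h := hγ y
    rw [hy, map_zero] at h
    obtain ⟨y', hy'⟩ := (Submodule.Quotient.mk_eq_zero I).1 h.symm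
    exact ⟨y', hy'.symm⟩
  obtain ⟨P, ρ, π, hρ, hsP, πs, πρ, kπ, F, hF, gen⟩ := glue_exists (R := R) s b m hbm
    (fun r => (ρ1 r).baseChange W) (fun r => (Algebra.lsmul k k M r).baseChange W)
    (fun r => (rM r).baseChange W) ρ2 α β hα hβ
    (by
      intro r x
      induction x with
      | zero => simp
      | add x y hx hy => simp only [map_add, hx, hy]
      | tmul w q =>
        simp only [α, LinearMap.baseChange_tmul]
        congr 1
        exact π1ρ r q)
    (by
      intro r x
      induction x with
      | zero => simp
      | add x y hx hy => simp only [map_add, hx, hy]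
      | tmul w q => 
        simp only [βt, LinearMap.baseChange_tmul]
        rfl)
    kα kβ j2 j2i j2ρ c2 π2 π2s π2ρ k2 ((fun q => (1 : W) ⊗ₜ[V] q) '' F1) (hF1.image _)
    (by
      intro S hS hFS
      let S1 : Submodule V Q1 := (S.restrictScalars V).comap (TensorProduct.mk V W Q1 1)
      have hS1 : S1 = ⊤ := gen1 S1 (by
        intro r q hq
        have := hS r _ hq
        simpa [S1] using this) (by
        intro q hq
        exact hFS ⟨q, hq, rfl⟩)
      rw [eq_top_iff]
      intro x _
      induction x with
      | zero => exact S.zero_mem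
      | add x y hx hy => exact S.add_mem (hx trivial) (hy trivial)
      | tmul w q =>
        have hq : q ∈ S1 := by rw [hS1]; trivial
        have h : (1 : W) ⊗ₜ[V] q ∈ S := hq
        have := S.smul_mem w h
        rwa [TensorProduct.smul_tmul', smul_eq_mul, mul_one] at this)
    F2 hF2 gen2
  let e : W ⊗[V] (V ⊗[k] L) ≃ₗ[W] W ⊗[k] L :=
    TensorProduct.AlgebraTensorModule.cancelBaseChange k V W W L
  let jX : W ⊗[V] Q1 →ₗ[W] W ⊗[k] L := e.toLinearMap ∘ₗ j1.baseChange W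
  have jXi : Function.Injective jX := by
    refine e.injective.comp ?_
    exact Module.Flat.lTensor_preserves_injective_linearMap j1 j1i
  have et : ∀ w v x, e (w ⊗ₜ (v ⊗ₜ x)) = (v • w) ⊗ₜ x := by
    intro w v x; simp [e]
  have jXρ : ∀ r x, jX ((ρ1 r).baseChange W x) = (Algebra.lsmul k k L r).baseChange W (jX x) := by
    intro r x
    induction x with
    | zero => simp
    | add x y hx hy => simp only [map_add, hx, hy]
    | tmul w q =>
      simp only [jX, LinearMap.comp_apply, LinearMap.baseChange_tmul, j1ρ, LinearEquiv.coe_coe]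
      generalize j1 q = z
      induction z with
      | zero => simp
      | add x y hx hy => simp only [map_add, hx, hy, TensorProduct.tmul_add]
      | tmul v x => simp only [LinearMap.baseChange_tmul, et]
  have jXc : ∀ y, ∃ x, jX x = s ^ (m * a) • y := by
    intro y
    induction y with
    | zero => exact ⟨0, by simp⟩
    | add x y hx hy =>
      obtain ⟨x', hx⟩ := hx
      obtain ⟨y', hy⟩ := hy
      exact ⟨x' + y', by rw [map_add, hx, hy, smul_add]⟩
    | tmul w x =>
      obtain ⟨q, hq⟩ := c1 (1 ⊗ₜ x)
      refine ⟨w ⊗ₜ q, ?_⟩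
      simp only [jX, LinearMap.comp_apply, LinearMap.baseChange_tmul, hq, LinearEquiv.coe_coe]
      rw [TensorProduct.smul_tmul', et, TensorProduct.smul_tmul', smul_eq_mul, mul_one,
        Algebra.smul_def, map_pow, hts, ← pow_mul, smul_eq_mul]
  refine ⟨P, inferInstance, inferInstance, ρ, jX ∘ₗ P.subtype, π, ?_, ?_, ?_, πs, πρ, kπ,
    F, hF, gen⟩
  · exact jXi.comp Subtype.val_injective
  · intro r p
    simp only [LinearMap.comp_apply, Submodule.subtype_apply, hρ]
    exact jXρ r p
  · intro y
    obtain ⟨x, hx⟩ := jXc y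
    refine ⟨⟨s ^ m • x, hsP x⟩, ?_⟩
    simp only [LinearMap.comp_apply, Submodule.subtype_apply, map_smul, hx]
    rw [smul_smul, ← pow_add, add_comm]

end Core
section Boundary
variable {k : Type} [Field k] {R : Type} [Ring R] [Algebra k R]

theorem algVK_injective (k : Type) [Field k] :
    Function.Injective (algebraMap (DegV k) (DegK k)) :=
  IsLocalization.injective (M := Submonoid.powers (degT k)) (DegK k)
    (powers_le_nonZeroDivisors_of_noZeroDivisors (degT_ne_zero k))

theorem comm_lTensor (M : Type) [AddCommGroup M] [Module k M] (c : DegK k) (z : M ⊗[k] DegK k) :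
    TensorProduct.comm k M (DegK k) (LinearMap.lTensor M (LinearMap.mulLeft k c) z)
      = c • TensorProduct.comm k M (DegK k) z := by
  induction z with
  | zero => simp
  | add x y hx hy => simp only [map_add, hx, hy, smul_add]
  | tmul m x => simp [TensorProduct.smul_tmul']

theorem comm_rTensor (M : Type) [AddCommGroup M] [Module k M] (g : M →ₗ[k] M)
    (z : M ⊗[k] DegK k) :
    TensorProduct.comm k M (DegK k) (LinearMap.rTensor (DegK k) g z)
      = g.baseChange (DegK k) (TensorProduct.comm k M (DegK k) z) := by
  induction z with
  | zero => simp
  | add x y hx hy => simp only [map_add, hx, hy]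
  | tmul m x => simp

theorem smulK_cancel (L : Type) [AddCommGroup L] [Module k L] (n : ℕ) {z z' : DegK k ⊗[k] L}
    (h : degT k ^ n • z = degT k ^ n • z') : z = z' := by
  have h5 : IsUnit (algebraMap (DegV k) (DegK k) (degT k ^ n)) :=
    IsLocalization.map_units (DegK k) (⟨degT k ^ n, n, rfl⟩ : Submonoid.powers (degT k))
  rwa [← algebraMap_smul (DegK k), ← algebraMap_smul (DegK k) (degT k ^ n),
    h5.smul_left_cancel] at h

theorem exists_iota (L : Type) [AddCommGroup L] [Module k L] :
    ∃ ι : DegV k ⊗[k] L →ₗ[DegV k] DegK k ⊗[k] L, Function.Injective ι ∧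
      (∀ v x, ι (v ⊗ₜ x) = algebraMap _ _ v ⊗ₜ x) ∧
      (∀ (g : L →ₗ[k] L) y, ι (g.baseChange (DegV k) y) = g.baseChange (DegK k) (ι y)) ∧
      (∀ z, ∃ (n : ℕ) (y : _), ι y = degT k ^ n • z) := by
  let ι : DegV k ⊗[k] L →ₗ[DegV k] DegK k ⊗[k] L :=
    TensorProduct.AlgebraTensorModule.map (Algebra.linearMap (DegV k) (DegK k)) LinearMap.id
  have ιt : ∀ v x, ι (v ⊗ₜ x) = algebraMap _ _ v ⊗ₜ x := fun v x => by simp [ι]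
  refine ⟨ι, ?_, ιt, ?_, ?_⟩
  · let ι' : DegV k →ₗ[k] DegK k := (Algebra.ofId (DegV k) (DegK k)).toLinearMap.restrictScalars k
    have hinj : Function.Injective ι' := algVK_injective k
    have h2 : Function.Injective (ι'.rTensor L) :=
      Module.Flat.rTensor_preserves_injective_linearMap ι' hinj
    have h3 : ∀ y, ι y = ι'.rTensor L y := by
      intro y
      induction y with
      | zero => simp
      | add x y hx hy => simp only [map_add, hx, hy]
      | tmul v x => rw [ιt, LinearMap.rTensor_tmul]; rfl
    intro x y hxy
    exact h2 (by rw [← h3, ← h3, hxy])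
  · intro g y
    induction y with
    | zero => simp
    | add x y hx hy => simp only [map_add, hx, hy]
    | tmul v x => simp only [LinearMap.baseChange_tmul, ιt]
  · intro z
    induction z with
    | zero => exact ⟨0, 0, by simp⟩
    | add x y hx hy =>
      obtain ⟨n, x', hx⟩ := hx
      obtain ⟨n', y', hy⟩ := hy
      refine ⟨n + n', degT k ^ n' • x' + degT k ^ n • y', ?_⟩
      rw [map_add, map_smul, map_smul, hx, hy, smul_add, smul_smul, smul_smul, ← pow_add,
        ← pow_add, add_comm n' n]
    | tmul c x =>
      obtain ⟨⟨v, ⟨_, n, rfl⟩⟩, hv⟩ := IsLocalization.surj (Submonoid.powers (degT k)) c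
      refine ⟨n, v ⊗ₜ x, ?_⟩
      rw [ιt, TensorProduct.smul_tmul', Algebra.smul_def, mul_comm]
      exact congrArg (· ⊗ₜ x) hv.symm

theorem bcK_smul {L : Type} [AddCommGroup L] [Module k L] (g : L →ₗ[k] L) (v : DegV k)
    (z : DegK k ⊗[k] L) : g.baseChange (DegK k) (v • z) = v • g.baseChange (DegK k) z :=
  LinearMap.map_smul_of_tower _ v z

/-- Unpacking the frozen definition. -/
theorem unpack_deg (M N : Type) [AddCommGroup M] [instk : Module k M] [Module R M]
    [IsScalarTower k R M] [AddCommGroup N] [Module R N] (h : Degenerates k R M N) :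
    ∃ (Q : Type) (_ : AddCommGroup Q) (_ : Module (DegV k) Q) (ρ : R → Q →ₗ[DegV k] Q)
      (j : Q →ₗ[DegV k] DegK k ⊗[k] M) (π : Q →+ N),
      Function.Injective j ∧
      (∀ r q, j (ρ r q) = (Algebra.lsmul k k M r).baseChange (DegK k) (j q)) ∧
      (∀ y, ∃ (n : ℕ) (q : Q), j q = degT k ^ n • y) ∧
      Function.Surjective π ∧
      (∀ r q, π (ρ r q) = r • π q) ∧
      (∀ q, π q = 0 ↔ ∃ q', q = degT k • q') ∧
      ∃ F : Set Q, F.Finite ∧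
        ∀ S : Submodule (DegV k) Q, (∀ r, ∀ x ∈ S, ρ r x ∈ S) → F ⊆ S → S = ⊤ := by
  have hk : instk = Module.compHom M (algebraMap k R) := by
    apply Module.ext
    funext c x
    exact (algebraMap_smul R c x).symm
  subst hk
  obtain ⟨Q, _, instA, hfin, hflat, ⟨e⟩, f, hfc, hfr⟩ := h
  let iV : Module (DegV k) Q := vRestrict k R Q
  have hflat' : Module.Flat (DegV k) Q := hflat
  have vs : ∀ (v : DegV k) (q : Q), v • q = ((1 : R) ⊗ₜ[k] v) • q := fun _ _ => rfl
  let : Module k M := Module.compHom M (algebraMap k R)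
  let mk1 : Q →ₗ[DegV k] LocalizedModule (Submonoid.powers (degT k)) Q :=
    LocalizedModule.mkLinearMap _ _
  let C := TensorProduct.comm k M (DegK k)
  have cs : ∀ (v : DegV k) (x : LocalizedModule (Submonoid.powers (degT k)) Q),
      v • x = algebraMap (DegV k) (DegK k) v • x := by
    intro v x
    exact (algebraMap_smul (Localization (Submonoid.powers (degT k))) v x).symm
  have fv : ∀ (v : DegV k) x, C (f (v • x)) = v • C (f x) := by
    intro v x
    rw [cs, hfc, comm_lTensor, algebraMap_smul]
  let j : Q →ₗ[DegV k] DegK k ⊗[k] M :=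
    { toFun := fun q => C (f (mk1 q))
      map_add' := fun x y => by simp only [map_add]
      map_smul' := fun v q => by rw [map_smul, fv]; rfl }
  let π : Q →+ N := e.toAddMonoidHom.comp
    ((LinearMap.range (tSmul k R Q)).mkQ).toAddMonoidHom
  refine ⟨Q, inferInstance, iV, rAct k R Q, j, π, ?_, ?_, ?_, ?_, ?_, ?_, ?_⟩
  · intro q q' h
    have h1 : mk1 q = mk1 q' := f.injective (C.injective h)
    obtain ⟨⟨_, n, rfl⟩, hc⟩ := IsLocalizedModule.exists_of_eq (S := Submonoid.powers (degT k)) h1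
    have hc' : degT k ^ n • q = degT k ^ n • q' := hc
    exact Module.Flat.isSMulRegular_of_nonZeroDivisors
      (mem_nonZeroDivisors_of_ne_zero (pow_ne_zero n (degT_ne_zero k))) hc'
  · intro r q
    have := hfr r (mk1 q)
    have h2 : LocalizedModule.map (Submonoid.powers (degT k)) (rAct k R Q r) (mk1 q)
        = mk1 (rAct k R Q r q) := by
      exact IsLocalizedModule.map_apply _ _ _ _ _
    rw [h2] at this
    change C (f (mk1 (rAct k R Q r q))) = _
    rw [this, comm_rTensor]
    rfl
  · intro y
    obtain ⟨⟨q, ⟨_, n, rfl⟩⟩, hq⟩ := IsLocalizedModule.surj (Submonoid.powers (degT k)) mk1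
      (f.symm (C.symm y))
    have hq' : degT k ^ n • (f.symm (C.symm y)) = mk1 q := hq
    refine ⟨n, q, ?_⟩
    change C (f (mk1 q)) = _
    rw [← hq', fv]
    simp
  · exact e.surjective.comp (Submodule.mkQ_surjective _)
  · intro r q
    exact @LinearEquiv.map_smul _ _ _ _ _ _ (rRestrict k R _) _ e r
      ((LinearMap.range (tSmul k R Q)).mkQ q)
  · intro q
    have : π q = 0 ↔ (LinearMap.range (tSmul k R Q)).mkQ q = 0 := by
      change e _ = 0 ↔ _
      exact EmbeddingLike.map_eq_zero_iff
    rw [this, Submodule.mkQ_apply, Submodule.Quotient.mk_eq_zero]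
    constructor
    · rintro ⟨q', h⟩
      exact ⟨q', h.symm⟩
    · rintro ⟨q', h⟩
      exact ⟨q', h.symm⟩
  · obtain ⟨F, hF⟩ := hfin.fg_top
    refine ⟨F, F.finite_toSet, ?_⟩
    intro S hS hFS
    let S' : Submodule (R ⊗[k] DegV k) Q :=
      { S.toAddSubmonoid with
        smul_mem' := by
          intro c x hx
          change x ∈ S at hx
          change c • x ∈ S
          induction c with
          | zero => rw [zero_smul]; exact S.zero_mem
          | add c d hc hd => rw [add_smul]; exact S.add_mem hc hd
          | tmul r v =>
            have : (r ⊗ₜ[k] v) • x = rAct k R Q r (v • x) := by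
              change _ = (r ⊗ₜ[k] (1 : DegV k)) • (((1 : R) ⊗ₜ[k] v) • x)
              rw [← mul_smul, Algebra.TensorProduct.tmul_mul_tmul, one_mul, mul_one]
            rw [this]
            exact hS r _ (S.smul_mem v hx) }
    have h' : (⊤ : Submodule (R ⊗[k] DegV k) Q) ≤ S' := by
      rw [← hF, Submodule.span_le]
      exact hFS
    rw [eq_top_iff]
    intro x _
    exact h' (Submodule.mem_top (x := x))

theorem preDeg_of_deg (M N : Type) [AddCommGroup M] [Module k M] [Module R M]
    [IsScalarTower k R M] [Module.Finite R M] [AddCommGroup N] [Module R N]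
    (h : Degenerates k R M N) :
    ∃ a, PreDeg k R (DegV k) (degT k) a M N := by
  classical
  obtain ⟨Q, _, _, ρ, j, π, ji, jρ, jc, πs, πρ, kπ, F, hF, gen⟩ := unpack_deg M N h
  obtain ⟨ι, ιi, ιt, ιρ, ιc⟩ := exists_iota (k := k) M
  have inf : ∀ z, ∃ (n : ℕ), ∀ n', n ≤ n' → ∃ y, ι y = degT k ^ n' • z := by
    intro z
    obtain ⟨n, y, hy⟩ := ιc z
    refine ⟨n, fun n' hn => ⟨degT k ^ (n' - n) • y, ?_⟩⟩
    rw [map_smul, hy, smul_smul, ← pow_add, Nat.sub_add_cancel hn]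
  -- uniform bound for `Q`
  choose nn hnn using inf
  obtain ⟨c, hc⟩ : ∃ c, ∀ q ∈ F, nn (j q) ≤ c := by
    obtain ⟨c, hc⟩ := (hF.image (fun q => nn (j q))).bddAbove
    exact ⟨c, fun q hq => hc ⟨q, hq, rfl⟩⟩
  have hQ : ∀ q, ∃ y, ι y = degT k ^ c • j q := by
    let S : Submodule (DegV k) Q := (LinearMap.range ι).comap (degT k ^ c • j)
    have hS : S = ⊤ := by
      apply gen
      · rintro r q ⟨y, hy⟩
        refine ⟨(Algebra.lsmul k k M r).baseChange (DegV k) y, ?_⟩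
        rw [ιρ, hy, LinearMap.smul_apply, LinearMap.smul_apply, jρ, bcK_smul]
      · intro q hq
        exact hnn _ c (hc q hq)
    intro q
    have : q ∈ S := by rw [hS]; trivial
    exact this
  choose J hJ using hQ
  let jV : Q →ₗ[DegV k] DegV k ⊗[k] M :=
    { toFun := J
      map_add' := fun x y => ιi (by rw [map_add, hJ, hJ, hJ, map_add, smul_add])
      map_smul' := fun v x => ιi (by
        rw [map_smul, hJ, hJ, map_smul, RingHom.id_apply, smul_comm]) }
  have hjV : ∀ q, ι (jV q) = degT k ^ c • j q := hJ
  -- uniform bound for `M`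
  obtain ⟨G, hG⟩ := (inferInstance : Module.Finite R M).fg_top
  choose n1 q1 h1 using fun x : M => jc ((1 : DegK k) ⊗ₜ x)
  obtain ⟨b, hb⟩ : ∃ b, ∀ x ∈ G, n1 x ≤ b := ⟨G.sup n1, fun x hx => Finset.le_sup hx⟩
  have hM : ∀ x : M, ∃ q, j q = degT k ^ b • ((1 : DegK k) ⊗ₜ x) := by
    let S : Submodule R M :=
      { carrier := {x | ∃ q, j q = degT k ^ b • ((1 : DegK k) ⊗ₜ x)}
        zero_mem' := ⟨0, by simp⟩
        add_mem' := by
          rintro x y ⟨q, hq⟩ ⟨q', hq'⟩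
          exact ⟨q + q', by rw [map_add, hq, hq', TensorProduct.tmul_add, smul_add]⟩
        smul_mem' := by
          rintro r x ⟨q, hq⟩
          refine ⟨ρ r q, ?_⟩
          rw [jρ, hq, bcK_smul]
          rfl }
    have : (⊤ : Submodule R M) ≤ S := by
      rw [← hG, Submodule.span_le]
      intro x hx
      refine ⟨degT k ^ (b - n1 x) • q1 x, ?_⟩
      rw [map_smul, h1, smul_smul, ← pow_add, Nat.sub_add_cancel (hb x hx)]
    intro x
    exact this (Submodule.mem_top (x := x))
  refine ⟨b + c, Q, inferInstance, inferInstance, ρ, jV, π, ?_, ?_, ?_, πs, πρ, kπ, F, hF, gen⟩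
  · intro q q' h
    have h2 := congrArg ι h
    rw [hjV, hjV] at h2
    exact ji (smulK_cancel M c h2)
  · intro r q
    apply ιi
    rw [hjV, ιρ, hjV, jρ, bcK_smul]
  · intro y
    induction y with
    | zero => exact ⟨0, by simp⟩
    | add x y hx hy =>
      obtain ⟨x', hx⟩ := hx
      obtain ⟨y', hy⟩ := hy
      exact ⟨x' + y', by rw [map_add, hx, hy, smul_add]⟩
    | tmul v x =>
      obtain ⟨q, hq⟩ := hM x
      refine ⟨v • q, ιi ?_⟩
      rw [hjV, map_smul, map_smul, hq, ιt, smul_comm v, TensorProduct.smul_tmul' v,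
        Algebra.smul_def, mul_one, smul_smul, ← pow_add, add_comm c b]


/-- Packing into the frozen definition. -/
theorem pack_deg (L N : Type) [AddCommGroup L] [instk : Module k L] [Module R L]
    [IsScalarTower k R L] [AddCommGroup N] [Module R N]
    (Q : Type) [AddCommGroup Q] [Module (R ⊗[k] DegV k) Q] (a : ℕ)
    (j : Q →+ DegV k ⊗[k] L) (π : Q →+ N) (hfin : Module.Finite (R ⊗[k] DegV k) Q)
    (ji : Function.Injective j) (jv : ∀ (v : DegV k) q, j (((1 : R) ⊗ₜ[k] v) • q) = v • j q)
    (jr : ∀ (r : R) q, j ((r ⊗ₜ[k] (1 : DegV k)) • q)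
      = (Algebra.lsmul k k L r).baseChange (DegV k) (j q))
    (jc : ∀ y, ∃ q, j q = degT k ^ a • y)
    (πs : Function.Surjective π)
    (πr : ∀ (r : R) q, π ((r ⊗ₜ[k] (1 : DegV k)) • q) = r • π q)
    (kπ : ∀ q, π q = 0 ↔ ∃ q', q = ((1 : R) ⊗ₜ[k] degT k) • q') :
    Degenerates k R L N := by
  have hk : instk = Module.compHom L (algebraMap k R) := by
    apply Module.ext
    funext c x
    exact (algebraMap_smul R c x).symm
  subst hk
  let iV : Module (DegV k) Q := vRestrict k R Q
  let : Module k L := Module.compHom L (algebraMap k R)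
  let jl : Q →ₗ[DegV k] DegV k ⊗[k] L :=
    { toFun := j, map_add' := map_add j, map_smul' := jv }
  refine ⟨Q, inferInstance, inferInstance, hfin, ?_, ?_, ?_⟩
  · change Module.Flat (DegV k) Q
    have : Module.IsTorsionFree (DegV k) Q :=
      Function.Injective.moduleIsTorsionFree jl ji (fun v q => map_smul jl v q)
    infer_instance
  · let T := LinearMap.range (tSmul k R Q)
    have hker : ∀ q, T.mkQ q = 0 ↔ π q = 0 := by
      intro q
      rw [kπ, Submodule.mkQ_apply, Submodule.Quotient.mk_eq_zero]
      constructor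
      · rintro ⟨q', h⟩
        exact ⟨q', h.symm⟩
      · rintro ⟨q', h⟩
        exact ⟨q', h.symm⟩
    let g : Q ⧸ T →+ N := (T.mkQ).toAddMonoidHom.liftOfSurjective T.mkQ_surjective
      ⟨π, fun q hq => (hker q).1 hq⟩
    have hg : ∀ q, g (T.mkQ q) = π q := by
      intro q
      exact AddMonoidHom.liftOfRightInverse_comp_apply _ _ _ _ q
    let iR : Module R (Q ⧸ T) := rRestrict k R (Q ⧸ T)
    let gl : (Q ⧸ T) →ₗ[R] N :=
      { toFun := g
        map_add' := map_add g
        map_smul' := fun r x => by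
          obtain ⟨q, rfl⟩ := T.mkQ_surjective x
          have : r • T.mkQ q = T.mkQ ((r ⊗ₜ[k] (1 : DegV k)) • q) := rfl
          rw [this, hg, hg, πr, RingHom.id_apply] }
    refine ⟨LinearEquiv.ofBijective gl ⟨?_, ?_⟩⟩
    · rw [injective_iff_map_eq_zero]
      intro x hx
      obtain ⟨q, rfl⟩ := T.mkQ_surjective x
      rw [hker, ← hg]
      exact hx
    · intro n
      obtain ⟨q, rfl⟩ := πs n
      exact ⟨T.mkQ q, hg q⟩
  · obtain ⟨ι, ιi, ιt, ιρ, ιc⟩ := exists_iota (k := k) L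
    let h : Q →ₗ[DegV k] DegK k ⊗[k] L := ι ∘ₗ jl
    have hloc : IsLocalizedModule (Submonoid.powers (degT k)) h := by
      refine ⟨?_, ?_, ?_⟩
      · rintro ⟨_, n, rfl⟩
        rw [Module.End.isUnit_iff]
        refine ⟨fun z z' hz => smulK_cancel L n hz, ?_⟩
        intro z
        have h5 : IsUnit (algebraMap (DegV k) (DegK k) (degT k ^ n)) :=
          IsLocalization.map_units (DegK k) (⟨degT k ^ n, n, rfl⟩ : Submonoid.powers (degT k))
        obtain ⟨u, hu⟩ := h5
        refine ⟨((u⁻¹ : (DegK k)ˣ) : DegK k) • z, ?_⟩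
        change degT k ^ n • (((u⁻¹ : (DegK k)ˣ) : DegK k) • z) = z
        rw [← algebraMap_smul (DegK k) (degT k ^ n), ← hu, smul_smul, Units.mul_inv, one_smul]
      · intro z
        obtain ⟨n, y, hy⟩ := ιc z
        obtain ⟨q, hq⟩ := jc y
        refine ⟨⟨q, ⟨degT k ^ (a + n), a + n, rfl⟩⟩, ?_⟩
        change degT k ^ (a + n) • z = ι (j q)
        rw [hq, map_smul, hy, smul_smul, pow_add]
      · intro x y hxy
        exact ⟨1, by rw [ji (ιi hxy)]⟩
    let E := IsLocalizedModule.iso (Submonoid.powers (degT k)) h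
    let C := TensorProduct.comm k L (DegK k)
    have hE1 : ∀ q, E (LocalizedModule.mk q 1) = h q := IsLocalizedModule.iso_mk_one _ _
    have cs : ∀ (v : DegV k) (x : LocalizedModule (Submonoid.powers (degT k)) Q),
        v • x = algebraMap (DegV k) (DegK k) v • x := by
      intro v x
      exact (algebraMap_smul (Localization (Submonoid.powers (degT k))) v x).symm
    refine ⟨E.toAddEquiv.trans C.symm.toAddEquiv, ?_, ?_⟩
    · intro c x
      apply C.injective
      rw [comm_lTensor]
      change C (C.symm (E (c • x))) = c • C (C.symm (E x))
      rw [LinearEquiv.apply_symm_apply, LinearEquiv.apply_symm_apply]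
      obtain ⟨⟨v, ⟨_, n, rfl⟩⟩, hv⟩ := IsLocalization.surj (Submonoid.powers (degT k)) c
      apply smulK_cancel L n
      have hv' : algebraMap (DegV k) (DegK k) (degT k ^ n) * c = algebraMap (DegV k) (DegK k) v := by
        rw [mul_comm]; exact hv
      rw [← map_smul, cs, smul_smul, hv', ← cs, map_smul, ← algebraMap_smul (DegK k) (degT k ^ n),
        smul_smul, hv', algebraMap_smul]
    · intro r x
      apply C.injective
      rw [comm_rTensor]
      change C (C.symm (E _)) = LinearMap.baseChange (DegK k) _ (C (C.symm (E x)))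
      rw [LinearEquiv.apply_symm_apply, LinearEquiv.apply_symm_apply]
      obtain ⟨⟨q, ⟨_, n, rfl⟩⟩, hq⟩ := IsLocalizedModule.surj (Submonoid.powers (degT k))
        (LocalizedModule.mkLinearMap (Submonoid.powers (degT k)) Q) x
      have hq' : degT k ^ n • x = LocalizedModule.mk q 1 := hq
      apply smulK_cancel L n
      have e1 : degT k ^ n • LocalizedModule.map (Submonoid.powers (degT k)) (rAct k R Q r) x
          = LocalizedModule.mk (rAct k R Q r q) 1 := by
        rw [← IsLocalizedModule.map_LocalizedModules, ← hq']
        exact (LinearMap.map_smul_of_tower (LocalizedModule.map (Submonoid.powers (degT k)) (rAct k R Q r)) (degT k ^ n) x).symm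
      rw [← map_smul, e1, hE1, ← bcK_smul, ← map_smul, hq', hE1]
      change ι (j ((r ⊗ₜ[k] (1 : DegV k)) • q)) = _
      rw [jr, ιρ]
      rfl

theorem deg_of_preDeg (L N : Type) [AddCommGroup L] [Module k L] [Module R L]
    [IsScalarTower k R L] [AddCommGroup N] [Module R N] (a : ℕ)
    (h : PreDeg k R (DegV k) (degT k) a L N) : Degenerates k R L N := by
  obtain ⟨Q, _, _, ρ, j, π, ji, jρ, jc, πs, πρ, kπ, F, hF, gen⟩ := h
  have bc : ∀ (r : R) v x, (Algebra.lsmul k k L r).baseChange (DegV k) (v ⊗ₜ x) = v ⊗ₜ (r • x) :=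
    fun r v x => rfl
  let iR : Module R Q :=
    { smul := fun r q => ρ r q
      one_smul := fun q => ji (by
        change j (ρ 1 q) = _
        rw [jρ, map_one]; 
        generalize j q = z
        induction z with
        | zero => simp
        | add x y hx hy => rw [map_add, hx, hy]
        | tmul v x => rfl)
      mul_smul := fun r r' q => ji (by
        change j (ρ (r * r') q) = j (ρ r (ρ r' q))
        rw [jρ, jρ, jρ, map_mul]
        generalize j q = z
        induction z with
        | zero => simp
        | add x y hx hy => simp only [map_add, hx, hy]
        | tmul v x => rfl)
      smul_zero := fun r => map_zero (ρ r)
      smul_add := fun r => map_add (ρ r)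
      add_smul := fun r r' q => ji (by
        change j (ρ (r + r') q) = j (ρ r q + ρ r' q)
        rw [jρ, map_add, map_add, jρ, jρ, LinearMap.baseChange_add, LinearMap.add_apply])
      zero_smul := fun q => ji (by
        change j (ρ 0 q) = _
        rw [jρ, map_zero, map_zero, LinearMap.baseChange_zero, LinearMap.zero_apply]) }
  have rs : ∀ (r : R) (q : Q), r • q = ρ r q := fun _ _ => rfl
  let : Module k Q := Module.compHom Q (algebraMap k (DegV k))
  have ks : ∀ (c : k) (q : Q), c • q = algebraMap k (DegV k) c • q := fun _ _ => rfl
  have : IsScalarTower k (DegV k) Q := IsScalarTower.of_algebraMap_smul fun c q => rfl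
  have : IsScalarTower k R Q := IsScalarTower.of_algebraMap_smul fun c q => ji (by
    rw [rs, jρ, ks, map_smul]
    generalize j q = z
    induction z with
    | zero => simp
    | add x y hx hy => rw [smul_add, ← hx, ← hy, map_add]
    | tmul v x => rw [bc, algebraMap_smul, algebraMap_smul, TensorProduct.tmul_smul])
  have : SMulCommClass R (DegV k) Q := ⟨fun r v q => map_smul (ρ r) v q⟩
  let iA : Module (R ⊗[k] DegV k) Q := TensorProduct.Algebra.module
  have as : ∀ (r : R) (v : DegV k) (q : Q), (r ⊗ₜ[k] v) • q = ρ r (v • q) := fun r v q =>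
    TensorProduct.Algebra.smul_def r v q
  have as1 : ∀ (v : DegV k) (q : Q), ((1 : R) ⊗ₜ[k] v) • q = v • q := fun v q => by
    rw [as]; exact one_smul R (v • q)
  refine pack_deg L N Q a j.toAddMonoidHom π ?_ ji ?_ ?_ jc πs ?_ ?_
  · refine ⟨⟨hF.toFinset, ?_⟩⟩
    rw [Set.Finite.coe_toFinset]
    let T := Submodule.span (R ⊗[k] DegV k) F
    let S : Submodule (DegV k) Q :=
      { T.toAddSubmonoid with
        smul_mem' := fun v x hx => by
          have := T.smul_mem ((1 : R) ⊗ₜ[k] v) hx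
          rwa [as1] at this }
    have hS : S = ⊤ := gen S (by
      intro r x hx
      have := T.smul_mem (r ⊗ₜ[k] (1 : DegV k)) hx
      rwa [as, one_smul] at this) Submodule.subset_span
    rw [eq_top_iff]
    intro x _
    have : x ∈ S := by rw [hS]; trivial
    exact this
  · intro v q
    rw [as1]; exact map_smul j v q
  · intro r q
    rw [as, one_smul]; exact jρ r q
  · intro r q
    rw [as, one_smul]; exact πρ r q
  · intro q
    rw [kπ]
    simp only [as1]

theorem PreDeg.congr {V : Type} [CommRing V] [Algebra k V] {t : V} {a : ℕ} {L L' N N' : Type}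
    [AddCommGroup L] [Module k L] [Module R L] [IsScalarTower k R L]
    [AddCommGroup L'] [Module k L'] [Module R L'] [IsScalarTower k R L']
    [AddCommGroup N] [Module R N] [AddCommGroup N'] [Module R N']
    (e : L ≃ₗ[R] L') (e' : N ≃ₗ[R] N') (h : PreDeg k R V t a L N) : PreDeg k R V t a L' N' := by
  obtain ⟨Q, _, _, ρ, j, π, ji, jρ, jc, πs, πρ, kπ, F, hF, gen⟩ := h
  let ek : L ≃ₗ[k] L' := e.restrictScalars k
  let E : V ⊗[k] L ≃ₗ[V] V ⊗[k] L' := TensorProduct.AlgebraTensorModule.congr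
    (LinearEquiv.refl V V) ek
  refine ⟨Q, inferInstance, inferInstance, ρ, E.toLinearMap ∘ₗ j,
    e'.toLinearMap.toAddMonoidHom.comp π, ?_, ?_, ?_, ?_, ?_, ?_, F, hF, gen⟩
  · exact E.injective.comp ji
  · intro r q
    change E (j (ρ r q)) = LinearMap.baseChange V _ (E (j q))
    rw [jρ]
    generalize j q = z
    induction z with
    | zero => simp
    | add x y hx hy => simp only [map_add, hx, hy]
    | tmul v x => 
      change v ⊗ₜ (e (r • x)) = v ⊗ₜ (r • e x)
      rw [map_smul]
  · intro y
    obtain ⟨q, hq⟩ := jc (E.symm y)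
    refine ⟨q, ?_⟩
    change E (j q) = _
    rw [hq, map_smul, LinearEquiv.apply_symm_apply]
  · exact e'.surjective.comp πs
  · intro r q
    change e' (π (ρ r q)) = r • e' (π q)
    rw [πρ, map_smul]
  · intro q
    rw [← kπ]
    change e' (π q) = 0 ↔ _
    exact e'.map_eq_zero_iff

end Boundary

/-- if `L ⇒_deg M` and `M ⇒_deg N` then `L^{⊕n} ⇒_deg N^{⊕n}`
for some `n > 0`. -/
theorem degenerates_trans_pow (k : Type) [Field k] (R : Type) [Ring R] [Algebra k R]
    (L M N : Type) [AddCommGroup L] [Module R L] [Module.Finite R L]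
    [AddCommGroup M] [Module R M] [Module.Finite R M]
    [AddCommGroup N] [Module R N] [Module.Finite R N]
    (h₁ : Degenerates k R L M) (h₂ : Degenerates k R M N) :
    ∃ n : ℕ, 0 < n ∧ Degenerates k R (Fin n → L) (Fin n → N) := by
  refine ⟨1, one_pos, ?_⟩
  let : Module k L := Module.compHom L (algebraMap k R)
  let : Module k M := Module.compHom M (algebraMap k R)
  have : IsScalarTower k R L := IsScalarTower.of_algebraMap_smul fun c x => rfl
  have : IsScalarTower k R M := IsScalarTower.of_algebraMap_smul fun c x => rfl
  obtain ⟨a, p₁⟩ := preDeg_of_deg L M h₁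
  obtain ⟨b, p₂⟩ := preDeg_of_deg M N h₂
  have p := PreDeg.trans (Nat.lt_succ_self b) (degPhi k (b + 1) b.succ_pos)
    (degPhi_t k (b + 1) b.succ_pos) (degPhi_injective k (b + 1) b.succ_pos) (degEps k)
    (degEps_eq_zero k) p₁ p₂
  exact deg_of_preDeg _ _ _ (p.congr (LinearEquiv.funUnique (Fin 1) R L).symm
    (LinearEquiv.funUnique (Fin 1) R N).symm)
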